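/- arXiv:2604.24891 — 2 statements merged into one kernel-verified Lean document; each statement's English description precedes it below -/
import Mathlib

section
/- Let G be a finite abelian group of order q, and let g_1, ..., g_L be sampled independently and uniformly at random from G, where L ≥ log_2 q. Then with probability at least 1 − q^2 · 2^{−L}, every element of G can be written as ε_1 g_1 + ... + ε_L g_L for some choice of ε_1, ..., ε_L ∈ {0,1}. -/
open Finset in
/-- Lower bound for the number of colliding pairs of a function between finite types, with an
extra term for the deviation of a single fibre from the mean fibre size. -/
theorem sq_card_div_le_sum_collisions {E G : Type*} [Fintype E] [Fintype G] [Nonempty G]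
    [DecidableEq G] (s : E → G) (y : G) :
    (Fintype.card E : ℝ) ^ 2 / Fintype.card G +
      ((∑ e, if s e = y then (1 : ℝ) else 0) - (Fintype.card E : ℝ) / Fintype.card G) ^ 2 ≤
      ∑ e, ∑ e', if s e = s e' then (1 : ℝ) else 0 := by
  have hq : (Fintype.card G : ℝ) ≠ 0 := by simp
  set f : G → ℝ := fun z ↦ ∑ e, if s e = z then (1 : ℝ) else 0 with hf
  set m : ℝ := (Fintype.card E : ℝ) / Fintype.card G with hm
  have hsum : ∑ z, f z = Fintype.card E := by
    simp only [hf]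
    rw [sum_comm]
    simp
  have hsq : ∑ z, f z ^ 2 = ∑ e, ∑ e', if s e = s e' then (1 : ℝ) else 0 := by
    simp only [hf, sq, sum_mul_sum]
    rw [sum_comm]
    refine sum_congr rfl fun e _ ↦ ?_
    rw [sum_comm]
    refine sum_congr rfl fun e' _ ↦ ?_
    simp [eq_comm]
  have hle : (f y - m) ^ 2 ≤ ∑ z, (f z - m) ^ 2 :=
    single_le_sum (f := fun z ↦ (f z - m) ^ 2) (fun _ _ ↦ sq_nonneg _) (mem_univ y)
  have hexp : ∑ z, (f z - m) ^ 2 = ∑ z, f z ^ 2 - (Fintype.card E : ℝ) ^ 2 / Fintype.card G := by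
    simp only [sub_sq, sum_add_distrib, sum_sub_distrib, ← sum_mul, ← mul_sum, hsum]
    simp only [sum_const, card_univ, nsmul_eq_mul, hm]
    field_simp
    ring
  rw [hexp, hsq] at hle
  linarith

/-- Subset sums of a uniform tuple along two distinct subsets collide with probability `1 / |G|`. -/
theorem card_subset_sum_eq {G ι : Type*} [AddCommGroup G] [Fintype G] [Fintype ι] [DecidableEq ι]
    [DecidableEq G] {ε ε' : ι → Bool} (h : ε ≠ ε') :
    Fintype.card G * Fintype.card {g : ι → G //
      ∑ i, (if ε i then g i else 0) = ∑ i, (if ε' i then g i else 0)} =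
      Fintype.card G ^ Fintype.card ι := by
  let φ : (ι → G) →+ G :=
    { toFun := fun g ↦ ∑ i, (if ε i then g i else 0) - ∑ i, (if ε' i then g i else 0)
      map_zero' := by simp
      map_add' := fun g h ↦ by
        rw [sub_add_sub_comm, ← Finset.sum_add_distrib, ← Finset.sum_add_distrib]
        congr 1 <;> refine Finset.sum_congr rfl fun i _ ↦ ?_ <;> split_ifs <;> simp }
  obtain ⟨i, hi⟩ := Function.ne_iff.mp h
  have hsingle (δ : ι → Bool) (x : G) :
      ∑ j, (if δ j then (Pi.single i x : ι → G) j else 0) = if δ i then x else 0 := by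
    rw [Finset.sum_eq_single i (fun j _ hj ↦ by simp [hj]) (by simp)]
    simp
  have hφ : Function.Surjective φ := by
    intro x
    cases hε : ε i
    · refine ⟨Pi.single i (-x), ?_⟩
      have hε' : ε' i = true := by simpa [hε] using hi
      change _ - _ = x
      rw [hsingle, hsingle]
      simp [hε, hε']
    · refine ⟨Pi.single i x, ?_⟩
      have hε' : ε' i = false := by simpa [hε] using hi
      change _ - _ = x
      rw [hsingle, hsingle]
      simp [hε, hε']
  have hcard := φ.ker.card_mul_index
  rw [AddSubgroup.index_ker, AddMonoidHom.range_eq_top.mpr hφ, AddSubgroup.card_top, mul_comm,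
    Nat.card_eq_fintype_card, Nat.card_eq_fintype_card (α := ι → G), Fintype.card_fun] at hcard
  rw [← hcard]
  congr 1
  rw [← Nat.card_eq_fintype_card]
  refine Nat.card_congr (Equiv.subtypeEquivRight (q := fun g ↦ g ∈ φ.ker) fun g ↦ ?_)
  exact sub_eq_zero.symm

open Finset in
/-- The total number of colliding pairs of subset sums, over all tuples `g : ι → G`. -/
theorem sum_subset_sum_collisions {G ι : Type*} [AddCommGroup G] [Fintype G] [Fintype ι]
    [DecidableEq ι] [DecidableEq G] :
    ∑ g : ι → G, ∑ ε : ι → Bool, ∑ ε' : ι → Bool,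
      (if ∑ i, (if ε i then g i else 0) = ∑ i, (if ε' i then g i else 0) then (1 : ℝ) else 0) =
    (Fintype.card G : ℝ) ^ Fintype.card ι * (2 ^ Fintype.card ι +
      ((2 ^ Fintype.card ι) ^ 2 - 2 ^ Fintype.card ι) / Fintype.card G) := by
  have hq : (Fintype.card G : ℝ) ≠ 0 := by simp
  rw [sum_comm]
  have key (ε ε' : ι → Bool) : ∑ g : ι → G, (if ∑ i, (if ε i then g i else 0) =
      ∑ i, (if ε' i then g i else 0) then (1 : ℝ) else 0) =
      (Fintype.card G : ℝ) ^ Fintype.card ι / Fintype.card G +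
      if ε = ε' then (Fintype.card G : ℝ) ^ Fintype.card ι -
        (Fintype.card G : ℝ) ^ Fintype.card ι / Fintype.card G else 0 := by
    split_ifs with h
    · simp [h]
    · rw [sum_boole, ← Fintype.card_subtype, add_zero, eq_div_iff hq, mul_comm]
      exact_mod_cast card_subset_sum_eq h
  have hε (ε : ι → Bool) := sum_comm (s := (univ : Finset (ι → G)))
    (t := (univ : Finset (ι → Bool))) (f := fun g ε' ↦ if ∑ i, (if ε i then g i else 0) =
      ∑ i, (if ε' i then g i else 0) then (1 : ℝ) else 0)
  simp only [hε, key, sum_add_distrib, sum_ite_eq, mem_univ, if_true, sum_const, card_univ,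
    nsmul_eq_mul, Fintype.card_fun, Fintype.card_bool, Nat.cast_pow, Nat.cast_ofNat]
  field_simp
  ring

/-- Second-moment bound for random subset sums in a finite abelian group: if
`g_1, …, g_L` are independent uniform elements of `G` (of order `q`) and
`L ≥ log₂ q`, then with probability at least `1 - q² 2^{-L}` every element of
`G` is a `{0,1}`-combination of the `g_i`.  The probability is expressed as
the proportion of good tuples among all `q^L` tuples. -/
theorem stmt11 (G : Type*) [AddCommGroup G] [Fintype G] (L : ℕ)
    (hL : Real.logb 2 (Fintype.card G) ≤ L) :
    1 - (Fintype.card G : ℝ) ^ 2 * (2 : ℝ) ^ (-(L : ℤ)) ≤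
      (Nat.card {g : Fin L → G // ∀ x : G, ∃ ε : Fin L → Bool,
          ∑ i, (if ε i then g i else 0) = x} : ℝ) / (Fintype.card G : ℝ) ^ L := by
  classical
  set q : ℝ := (Fintype.card G : ℝ) with hq_def
  have hq : 0 < q := by simp [hq_def, Fintype.card_pos]
  set P : (Fin L → G) → Prop := fun g ↦ ∀ x : G, ∃ ε : Fin L → Bool,
    ∑ i, (if ε i then g i else 0) = x with hP
  set A : ℝ := (Nat.card {g // P g} : ℝ) with hA
  set M : ℝ := 2 ^ L with hM
  have hM0 : 0 < M := by positivity
  have hcardA : A = ∑ g, if P g then (1 : ℝ) else 0 := by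
    rw [hA, Nat.card_eq_fintype_card, Fintype.card_subtype, Finset.sum_boole]
  have hcard : (Fintype.card (Fin L → Bool) : ℝ) = M := by simp [hM]
  have hbase (g : Fin L → G) : M ^ 2 / q + (M / q) ^ 2 * (1 - if P g then (1 : ℝ) else 0) ≤
      ∑ ε : Fin L → Bool, ∑ ε' : Fin L → Bool, (if ∑ i, (if ε i then g i else 0) =
        ∑ i, (if ε' i then g i else 0) then (1 : ℝ) else 0) := by
    by_cases hg : P g
    · have h := sq_card_div_le_sum_collisions
        (fun ε : Fin L → Bool ↦ ∑ i, (if ε i then g i else 0)) 0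
      simp only [hcard, ← hq_def] at h
      simp only [hg, if_true, sub_self, mul_zero, add_zero]
      exact (le_add_of_nonneg_right (sq_nonneg _)).trans h
    · obtain ⟨y, hy⟩ : ∃ y, ∀ ε : Fin L → Bool, ∑ i, (if ε i then g i else 0) ≠ y := by
        simpa only [hP, not_forall, not_exists] using hg
      have h := sq_card_div_le_sum_collisions
        (fun ε : Fin L → Bool ↦ ∑ i, (if ε i then g i else 0)) y
      simp only [hy, if_false, Finset.sum_const_zero, zero_sub, neg_sq, hcard, ← hq_def] at h
      simpa only [hg, if_false, sub_zero, mul_one] using h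
  have hsum := Finset.sum_le_sum fun g (_ : g ∈ Finset.univ) ↦ hbase g
  rw [sum_subset_sum_collisions, Finset.sum_add_distrib, ← Finset.mul_sum,
    Finset.sum_sub_distrib, ← hcardA] at hsum
  simp only [Finset.sum_const, Finset.card_univ, nsmul_eq_mul, Fintype.card_fun, Fintype.card_fin,
    Nat.cast_pow, mul_one, ← hq_def, ← hM] at hsum
  have hQ : 0 < q ^ L := by positivity
  rw [zpow_neg, zpow_natCast, ← hM, le_div_iff₀ hQ]
  have hbound : (M / q) ^ 2 * (q ^ L - A) ≤ q ^ L * M := by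
    have : q ^ L * (M + (M ^ 2 - M) / q) = q ^ L * M + q ^ L * (M ^ 2 / q) - q ^ L * (M / q) := by
      ring
    have : 0 ≤ q ^ L * (M / q) := by positivity
    linarith
  have hfin : q ^ L - A ≤ q ^ 2 * M⁻¹ * q ^ L := by
    calc q ^ L - A = (q / M) ^ 2 * ((M / q) ^ 2 * (q ^ L - A)) := by field_simp
      _ ≤ (q / M) ^ 2 * (q ^ L * M) := by gcongr
      _ = q ^ 2 * M⁻¹ * q ^ L := by field_simp
  linarith
end

section
/- Let q, L be positive integers with log_2 q ≤ L ≤ q^{1/2}, let G be an abelian group of order q, and let A ⊆ G be a uniformly random subset of size L. Then FS(A) = G with probability at least 1 − q^2 · 2^{1−L}. -/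
/-- The subset sums of a family `g` indexed by two distinct index sets agree for exactly a
proportion `1 / |G|` of all families. -/
theorem card_filter_sum_eq_sum_mul_card {G ι : Type*} [AddCommGroup G] [Fintype G] [DecidableEq G]
    [Fintype ι] [DecidableEq ι] {S T : Finset ι} (hST : S ≠ T) :
    Fintype.card G * (Finset.univ.filter
      fun g : ι → G => ∑ i ∈ S, g i = ∑ i ∈ T, g i).card = Fintype.card (ι → G) := by
  let φ : (ι → G) →+ G :=
    { toFun := fun g => ∑ i ∈ S, g i - ∑ i ∈ T, g i
      map_zero' := by simp
      map_add' := fun a b => by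
        simp only [Pi.add_apply, Finset.sum_add_distrib]
        abel }
  have hφ : Function.Surjective φ := by
    obtain ⟨i, hi⟩ : ∃ i, ¬ (i ∈ S ↔ i ∈ T) := by
      by_contra! h
      exact hST (Finset.ext h)
    intro x
    by_cases hS : i ∈ S
    · have hT : i ∉ T := fun h => hi ⟨fun _ => h, fun _ => hS⟩
      exact ⟨Pi.single i x, by simp [φ, hS, hT]⟩
    · have hT : i ∈ T := by tauto
      exact ⟨Pi.single i (-x), by simp [φ, hS, hT]⟩
  have hker : Nat.card φ.ker = (Finset.univ.filter
      fun g : ι → G => ∑ i ∈ S, g i = ∑ i ∈ T, g i).card := by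
    rw [← Nat.card_eq_finsetCard]
    refine Nat.card_congr (Equiv.subtypeEquivRight fun g => ?_)
    simp [φ, AddMonoidHom.mem_ker, sub_eq_zero]
  have h := φ.ker.card_mul_index
  rw [AddSubgroup.index_ker, AddMonoidHom.range_eq_top.2 hφ, hker] at h
  simpa [mul_comm, Nat.card_eq_fintype_card] using h

/-- Second-moment bound: the families whose subset sums miss some element of `G` form a proportion
of at most `|G|² / 2 ^ |ι|` of all families. -/
theorem card_filter_exists_sum_ne_mul_le {G ι : Type*} [AddCommGroup G] [Fintype G]
    [DecidableEq G] [Fintype ι] [DecidableEq ι] :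
    ((Finset.univ.filter fun g : ι → G => ∃ x, ∀ S : Finset ι, ∑ i ∈ S, g i ≠ x).card : ℝ) *
      2 ^ Fintype.card ι ≤ (Fintype.card G : ℝ) ^ 2 * Fintype.card (ι → G) := by
  set q : ℝ := (Fintype.card G : ℝ) with hq
  set Q : ℝ := (Fintype.card (ι → G) : ℝ) with hQ
  set n : ℝ := 2 ^ Fintype.card ι with hn
  have hn0 : 0 < n := by positivity
  have hncard : ((Finset.univ : Finset (Finset ι)).card : ℝ) = n := by simp [hn]
  let N : (ι → G) → G → ℝ := fun g x => ∑ S : Finset ι, if ∑ i ∈ S, g i = x then 1 else 0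
  have hN1 (g : ι → G) : ∑ x, N g x = n := by
    simp only [N]
    rw [Finset.sum_comm]
    simp [hn]
  have hN2 (g : ι → G) : ∑ x, N g x ^ 2 =
      ∑ S : Finset ι, ∑ T : Finset ι, if ∑ i ∈ S, g i = ∑ i ∈ T, g i then (1 : ℝ) else 0 := by
    simp only [N, sq, Finset.sum_mul_sum]
    rw [Finset.sum_comm]
    refine Finset.sum_congr rfl fun S _ => ?_
    rw [Finset.sum_comm]
    refine Finset.sum_congr rfl fun T _ => ?_
    simp [eq_comm]
  have hpair (S T : Finset ι) :
      q * ∑ g : ι → G, (if ∑ i ∈ S, g i = ∑ i ∈ T, g i then (1 : ℝ) else 0) =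
        Q + if S = T then (q - 1) * Q else 0 := by
    split_ifs with h
    · subst h
      simp [hQ]
      ring
    · rw [Finset.sum_boole, add_zero, hq, hQ]
      exact_mod_cast card_filter_sum_eq_sum_mul_card (G := G) h
  have hsecond : q * ∑ g : ι → G, ∑ x, N g x ^ 2 = n ^ 2 * Q + n * ((q - 1) * Q) := by
    simp only [hN2]
    rw [Finset.sum_comm, Finset.mul_sum]
    have (S : Finset ι) : q * ∑ g : ι → G, ∑ T : Finset ι,
        (if ∑ i ∈ S, g i = ∑ i ∈ T, g i then (1 : ℝ) else 0) = n * Q + (q - 1) * Q := by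
      rw [Finset.sum_comm, Finset.mul_sum]
      simp only [hpair, Finset.sum_add_distrib, Finset.sum_const, nsmul_eq_mul, hncard]
      simp
    simp only [this, Finset.sum_const, nsmul_eq_mul, hncard]
    ring
  have hvar : ∑ g : ι → G, ∑ x, (q * N g x - n) ^ 2 = q * n * Q * (q - 1) := by
    have (g : ι → G) : ∑ x, (q * N g x - n) ^ 2 = q ^ 2 * ∑ x, N g x ^ 2 - q * n ^ 2 := by
      have h (x : G) : (q * N g x - n) ^ 2 = q ^ 2 * N g x ^ 2 - 2 * q * n * N g x + n ^ 2 := by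
        ring
      simp only [h, Finset.sum_add_distrib, Finset.sum_sub_distrib, ← Finset.mul_sum, hN1,
        Finset.sum_const, nsmul_eq_mul, Finset.card_univ, ← hq]
      ring
    simp only [this, Finset.sum_sub_distrib, ← Finset.mul_sum, Finset.sum_const, nsmul_eq_mul,
      Finset.card_univ, ← hQ]
    linear_combination q * hsecond
  have hbad : ((Finset.univ.filter
      fun g : ι → G => ∃ x, ∀ S : Finset ι, ∑ i ∈ S, g i ≠ x).card : ℝ) * n ^ 2 ≤
        ∑ g : ι → G, ∑ x, (q * N g x - n) ^ 2 := by
    rw [← nsmul_eq_mul, ← Finset.sum_const]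
    refine (Finset.sum_le_sum fun g hg => ?_).trans
      (Finset.sum_le_univ_sum_of_nonneg fun g => Finset.sum_nonneg fun x _ => sq_nonneg _)
    obtain ⟨x, hx⟩ := (Finset.mem_filter.1 hg).2
    have hNx : N g x = 0 := by simp [N, hx]
    calc n ^ 2 = (q * N g x - n) ^ 2 := by rw [hNx]; ring
      _ ≤ _ := Finset.single_le_sum (f := fun x => (q * N g x - n) ^ 2)
        (fun x _ => sq_nonneg _) (Finset.mem_univ x)
  rw [hvar] at hbad
  have hq0 : 0 ≤ q := by positivity
  have hQ0 : 0 ≤ Q := by positivity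
  refine le_of_mul_le_mul_right ?_ hn0
  nlinarith [mul_nonneg (mul_nonneg hq0 hn0.le) hQ0]

/-- Ordering the elements of each `L`-element set with incomplete subset sums in all `L!` ways
gives distinct families with incomplete subset sums. -/
theorem card_filter_powersetCard_mul_factorial_le {G : Type*} [AddCommGroup G] [Fintype G]
    [DecidableEq G] (L : ℕ) :
    (Finset.univ.filter fun A : Finset G =>
      A.card = L ∧ ¬ ∀ x : G, ∃ B ⊆ A, ∑ b ∈ B, b = x).card * L.factorial ≤
    (Finset.univ.filter
      fun g : Fin L → G => ∃ x, ∀ S : Finset (Fin L), ∑ i ∈ S, g i ≠ x).card := by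
  set bad := Finset.univ.filter fun A : Finset G =>
    A.card = L ∧ ¬ ∀ x : G, ∃ B ⊆ A, ∑ b ∈ B, b = x with hbad
  have hcard : (bad.sigma fun A => (Finset.univ : Finset (Fin L ≃ A))).card =
      bad.card * L.factorial := by
    rw [Finset.card_sigma, Finset.sum_const_nat]
    intro A hA
    have hA' : A.card = L := (Finset.mem_filter.1 hA).2.1
    rw [Finset.card_univ, Fintype.card_equiv (Fintype.equivOfCardEq (by simp [hA'])),
      Fintype.card_fin]
  rw [← hcard]
  refine Finset.card_le_card_of_injOn (fun p i => (p.2 i : G)) ?_ ?_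
  · rintro ⟨A, e⟩ hp
    simp only [Finset.coe_sigma, Set.mem_sigma_iff, Finset.mem_coe] at hp
    obtain ⟨-, h⟩ := (Finset.mem_filter.1 hp.1).2
    push Not at h
    obtain ⟨x, hx⟩ := h
    simp only [Finset.coe_filter, Finset.mem_univ, true_and, Set.mem_ofPred_eq]
    refine ⟨x, fun S hS => hx (S.image fun i => (e i : G)) ?_ ?_⟩
    · intro y hy
      obtain ⟨i, -, rfl⟩ := Finset.mem_image.1 hy
      exact (e i).2
    · rw [Finset.sum_image fun i _ j _ hij => e.injective (Subtype.ext hij)]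
      exact hS
  · rintro ⟨A, e⟩ - ⟨B, f⟩ - h
    have hi (i : Fin L) : (e i : G) = f i := congrFun h i
    obtain rfl : A = B := by
      ext y
      constructor
      · intro hy
        have := hi (e.symm ⟨y, hy⟩)
        rw [Equiv.apply_symm_apply] at this
        change y = _ at this
        rw [this]
        exact (f _).2
      · intro hy
        have := hi (f.symm ⟨y, hy⟩)
        rw [Equiv.apply_symm_apply] at this
        change _ = y at this
        rw [← this]
        exact (e _).2
    obtain rfl : e = f := Equiv.ext fun i => Subtype.ext (hi i)
    rfl

theorem two_mul_sub_mul_pow_le_descFactorial {q k : ℕ} (hk : k ≤ q) :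
    (2 * q - k * (k - 1) : ℝ) * q ^ k ≤ 2 * q * q.descFactorial k := by
  induction k with
  | zero => simp
  | succ k ih =>
    have hkq : (k : ℝ) ≤ q := by exact_mod_cast (Nat.le_succ k).trans hk
    have hcube : (0 : ℝ) ≤ k ^ 2 * (k - 1) := by
      rcases Nat.eq_zero_or_pos k with rfl | h
      · simp
      · have : (1 : ℝ) ≤ k := by exact_mod_cast h
        exact mul_nonneg (sq_nonneg _) (by linarith)
    rw [Nat.descFactorial_succ]
    push_cast [Nat.cast_sub ((Nat.le_succ k).trans hk)]
    have h1 := mul_le_mul_of_nonneg_left (ih ((Nat.le_succ k).trans hk)) (sub_nonneg.2 hkq)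
    have h2 := mul_nonneg hcube (pow_nonneg (Nat.cast_nonneg (α := ℝ) q) k)
    rw [pow_succ]
    nlinarith

/-- Lemma 3.1: if `G` is an abelian group of order `q` and `log₂ q ≤ L ≤ √q`,
then a uniformly random `L`-element subset `A ⊆ G` satisfies `FS(A) = G` with
probability at least `1 - q² · 2^{1-L}`.  The probability is expressed as the
proportion of good subsets among all `C(q,L)` subsets of size `L`. -/
theorem stmt13 (G : Type*) [AddCommGroup G] [Fintype G] [DecidableEq G] (q L : ℕ)
    (hq : q = Fintype.card G) (hlog : Real.logb 2 q ≤ L) (hL : 0 < L)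
    (hLq : (L : ℝ) ≤ Real.sqrt q) :
    1 - (q : ℝ) ^ 2 * (2 : ℝ) ^ (1 - (L : ℤ)) ≤
      (Nat.card {A : Finset G // A.card = L ∧
          ∀ x : G, ∃ B ⊆ A, ∑ b ∈ B, b = x} : ℝ) / (q.choose L : ℝ) := by
  have hq0 : (0 : ℝ) < q := by
    rw [hq]
    exact_mod_cast Fintype.card_pos
  have hsq : (L : ℝ) ^ 2 ≤ q := (Real.le_sqrt (by positivity) hq0.le).1 hLq
  have hLle : L ≤ q := by
    have : L ^ 2 ≤ q := by exact_mod_cast hsq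
    nlinarith
  have hC : (0 : ℝ) < q.choose L := by exact_mod_cast Nat.choose_pos hLle
  have hfact : (0 : ℝ) < L.factorial := by exact_mod_cast L.factorial_pos
  have hpow : (0 : ℝ) < 2 ^ L := by positivity
  set good := Finset.univ.filter fun A : Finset G =>
    A.card = L ∧ ∀ x : G, ∃ B ⊆ A, ∑ b ∈ B, b = x with hgood
  set bad := Finset.univ.filter fun A : Finset G =>
    A.card = L ∧ ¬ ∀ x : G, ∃ B ⊆ A, ∑ b ∈ B, b = x with hbad
  have hcard : Nat.card {A : Finset G // A.card = L ∧ ∀ x : G, ∃ B ⊆ A, ∑ b ∈ B, b = x} =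
      good.card := by
    rw [Nat.card_eq_fintype_card, Fintype.card_subtype]
  have hsum : good.card + bad.card = q.choose L := by
    rw [hgood, hbad, ← Finset.filter_filter, ← Finset.filter_filter,
      Finset.card_filter_add_card_filter_not, hq, ← Finset.card_univ, ← Finset.card_powersetCard]
    congr 1
    ext A
    simp [Finset.mem_powersetCard]
  have hsumR : (good.card : ℝ) + bad.card = q.choose L := by exact_mod_cast hsum
  have hsecond := card_filter_exists_sum_ne_mul_le (G := G) (ι := Fin L)
  have horder := Nat.cast_le (α := ℝ).2 (card_filter_powersetCard_mul_factorial_le (G := G) L)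
  rw [← hbad, Nat.cast_mul] at horder
  rw [Fintype.card_fun, Fintype.card_fin, ← hq] at hsecond
  push_cast at hsecond
  have hdesc : (q : ℝ) ^ L ≤ 2 * (L.factorial * q.choose L) := by
    have h := two_mul_sub_mul_pow_le_descFactorial hLle
    rw [Nat.descFactorial_eq_factorial_mul_choose] at h
    push_cast at h
    have h' : (q : ℝ) * q ^ L ≤ (2 * q - L * (L - 1)) * q ^ L := by
      have : (0 : ℝ) ≤ L := by positivity
      exact mul_le_mul_of_nonneg_right (by nlinarith) (by positivity)
    exact le_of_mul_le_mul_left (by linarith) hq0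
  have hmain : (bad.card : ℝ) * 2 ^ L ≤ q ^ 2 * 2 * q.choose L := by
    refine le_of_mul_le_mul_right ?_ hfact
    have h1 := mul_le_mul_of_nonneg_right horder hpow.le
    have h2 := mul_le_mul_of_nonneg_left hdesc (sq_nonneg (q : ℝ))
    linarith
  rw [hcard, le_div_iff₀ hC, zpow_sub₀ two_ne_zero, zpow_one, zpow_natCast]
  have hbadle : (bad.card : ℝ) ≤ q ^ 2 * (2 / 2 ^ L) * q.choose L := by
    refine ((le_div_iff₀ hpow).2 hmain).trans_eq ?_
    ring
  linarith
end
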